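/- Let λ ∈ ℝ and let M be the 7×7 real matrix with rows and columns indexed by {0,1,…,6} (indices 1,…,6 arranged cyclically), defined by M₀₀ = (3/2)(4−λ); M_{ii} = (4−λ) for 1 ≤ i ≤ 6; M_{0i} = M_{i0} = −1 for 1 ≤ i ≤ 6; and for distinct i, j ∈ {1,…,6}, M_{ij} = −1 if i and j are cyclically adjacent and M_{ij} = 0 otherwise. Then det M = (3/2)·(6−λ)·(5−λ)²·(3−λ)²·(4 − 6λ + λ²) = (6−λ)·φ(λ)²/(6·(4 − 6λ + λ²)), where φ(λ) = 3(5−λ)(3−λ)(4−6λ+λ²). Consequently, for t ≠ 0 and B = (15/7)·t·M with (6−λ)·φ(λ) ≠ 0, the resolvent prekernel G = B^{-1} of SG₃ satisfies det G = (7/15)⁷ · 6·(4 − 6λ + λ²)/((6 − λ)·φ(λ)²·t⁷). -/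

import Mathlib

open Matrix

/-- `φ(λ) = 3(5−λ)(3−λ)(4−6λ+λ²)` for `SG₃`. -/
noncomputable def phiSG3 (l : ℝ) : ℝ := 3 * (5 - l) * (3 - l) * (4 - 6*l + l^2)

/-- The matrix `M` with `B = (15/7)·τ(λ)·M`, indexed by the central vertex `0` and the
cyclically arranged hexagon vertices `1,…,6` of `V₁∖V₀` in `SG₃`. -/
noncomputable def Msg3 (l : ℝ) : Matrix (Fin 7) (Fin 7) ℝ :=
  !![3/2*(4 - l), -1, -1, -1, -1, -1, -1;
     -1, 4 - l, -1,  0,  0,  0, -1;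
     -1, -1, 4 - l, -1,  0,  0,  0;
     -1,  0, -1, 4 - l, -1,  0,  0;
     -1,  0,  0, -1, 4 - l, -1,  0;
     -1,  0,  0,  0, -1, 4 - l, -1;
     -1, -1,  0,  0,  0, -1, 4 - l]

/-- The change of basis adapted to the antipodal symmetry `i ↦ i + 3` of the hexagon. -/
def antipodalBasis : Matrix (Fin 7) (Fin 7) ℝ :=
  !![1, 0, 0, 0, 0, 0, 0;
     0, 1, 0, 0, 0, 0, 0;
     0, 0, 1, 0, 0, 0, 0;
     0, 0, 0, 1, 0, 0, 0;
     0, 1, 0, 0, 1, 0, 0;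
     0, 0, 1, 0, 0, 1, 0;
     0, 0, 0, 1, 0, 0, 1]

theorem det_antipodalBasis : antipodalBasis.det = 1 := by
  rw [det_of_isLowerTriangular]
  · simp [antipodalBasis, Fin.prod_univ_succ]
  · intro i j hij
    change i < j at hij
    fin_cases i <;> fin_cases j <;> first | rfl | exact absurd hij (by decide)

/-- The block of `Msg3 l` acting on antipodally symmetric vectors. -/
noncomputable def symmetricBlock (l : ℝ) : Matrix (Fin 4) (Fin 4) ℝ :=
  !![3/2*(4 - l), -2, -2, -2;
     -1, 4 - l, -1, -1;
     -1, -1, 4 - l, -1;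
     -1, -1, -1, 4 - l]

/-- The block of `Msg3 l` acting on the quotient by antipodally symmetric vectors. -/
def antisymmetricBlock (l : ℝ) : Matrix (Fin 3) (Fin 3) ℝ :=
  !![4 - l, -1, 1;
     -1, 4 - l, -1;
     1, -1, 4 - l]

theorem det_symmetricBlock (l : ℝ) :
    (symmetricBlock l).det = 3/2 * (5 - l)^2 * (4 - 6*l + l^2) := by
  simp [symmetricBlock, det_succ_row_zero, Fin.sum_univ_succ, Fin.succAbove]
  ring

theorem det_antisymmetricBlock (l : ℝ) :
    (antisymmetricBlock l).det = (6 - l) * (3 - l)^2 := by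
  simp [antisymmetricBlock, det_fin_three]
  ring

/-- `Msg3 l` in the basis `antipodalBasis`. -/
noncomputable def blockMsg3 (l : ℝ) : Matrix (Fin 7) (Fin 7) ℝ :=
  !![3/2*(4 - l), -2, -2, -2, -1, -1, -1;
     -1, 4 - l, -1, -1, 0, 0, -1;
     -1, -1, 4 - l, -1, 0, 0, 0;
     -1, -1, -1, 4 - l, -1, 0, 0;
     0, 0, 0, 0, 4 - l, -1, 1;
     0, 0, 0, 0, -1, 4 - l, -1;
     0, 0, 0, 0, 1, -1, 4 - l]

theorem Msg3_mul_antipodalBasis (l : ℝ) :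
    Msg3 l * antipodalBasis = antipodalBasis * blockMsg3 l := by
  ext i j
  fin_cases i <;> fin_cases j <;>
    simp [Msg3, antipodalBasis, blockMsg3, mul_apply, Fin.sum_univ_succ] <;> ring

theorem blockMsg3_submatrix (l : ℝ) :
    (blockMsg3 l).submatrix finSumFinEquiv finSumFinEquiv =
      fromBlocks (symmetricBlock l) !![-1, -1, -1; 0, 0, -1; 0, 0, 0; -1, 0, 0] 0
        (antisymmetricBlock l) := by
  ext i j
  rcases i with i | i <;> rcases j with j | j <;> fin_cases i <;> fin_cases j <;> rfl

theorem Msg3_det (l : ℝ) :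
    (Msg3 l).det = 3/2 * (6 - l) * (5 - l)^2 * (3 - l)^2 * (4 - 6*l + l^2) := by
  have hconj := congrArg det (Msg3_mul_antipodalBasis l)
  rw [det_mul, det_mul, det_antipodalBasis, mul_one, one_mul] at hconj
  have hblock := det_submatrix_equiv_self (finSumFinEquiv (m := 4) (n := 3)) (blockMsg3 l)
  rw [hconj, ← hblock, blockMsg3_submatrix, det_fromBlocks_zero₂₁, det_symmetricBlock,
    det_antisymmetricBlock]
  ring

/-- Determinant of `M`, and consequently the determinant of the resolvent
prekernel `G = B⁻¹` of `SG₃`. -/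
theorem sg3_prekernel_determinant (l : ℝ) :
    (Msg3 l).det = 3/2 * (6 - l) * (5 - l)^2 * (3 - l)^2 * (4 - 6*l + l^2) ∧
    (Msg3 l).det = (6 - l) * (phiSG3 l)^2 / (6 * (4 - 6*l + l^2)) ∧
    (∀ t : ℝ, t ≠ 0 → (6 - l) * phiSG3 l ≠ 0 →
      ((((15/7 : ℝ) * t) • Msg3 l)⁻¹).det =
        (7/15 : ℝ)^7 * (6 * (4 - 6*l + l^2)) / ((6 - l) * (phiSG3 l)^2 * t^7)) := by
  have hphi : phiSG3 l = 3 * (5 - l) * (3 - l) * (4 - 6*l + l^2) := rfl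
  have hdet : (Msg3 l).det = (6 - l) * (phiSG3 l)^2 / (6 * (4 - 6*l + l^2)) := by
    rw [Msg3_det, hphi]
    by_cases hq : 4 - 6*l + l^2 = 0
    · simp [hq]
    · field_simp
      ring
  refine ⟨Msg3_det l, hdet, fun t ht hne => ?_⟩
  have hq : 4 - 6*l + l^2 ≠ 0 := fun h => hne (by simp [hphi, h])
  obtain ⟨h6, hp⟩ := mul_ne_zero_iff.mp hne
  rw [det_nonsing_inv, Ring.inverse_eq_inv', det_smul, Fintype.card_fin, hdet]
  field_simp
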